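/- Let O be an order in a number field. Then O is a Dedekind domain (equivalently O = O_K) if and only if every finite set of nonzero ideals I1,…,Ir of O satisfies: for all a1,…,ar ∈ O, |π(∪_j (aj+Ij))| ≥ |π(∪_j Ij)|, where π : O → O/(∩_j Ij) is the projection onto the finite quotient. -/

import Mathlib

section Translates

variable {ι κ : Type*} {G : ι → Type*} [∀ i, AddCommGroup (G i)]

/-- Replacing the `i₀`-th coordinates of the translation vectors by `0` does not enlarge a finite
union of translates of product subgroups, if the `i₀`-th factors form a chain. -/
theorem ncard_setOf_sub_update_le [Finite κ] [Finite (∀ i, G i)] [DecidableEq ι]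
    (H : κ → ∀ i, AddSubgroup (G i)) (i₀ : ι) (hH : ∀ j k, H j i₀ ≤ H k i₀ ∨ H k i₀ ≤ H j i₀)
    (a : κ → ∀ i, G i) :
    {x : ∀ i, G i | ∃ j, ∀ i, x i - Function.update (a j) i₀ 0 i ∈ H j i}.ncard ≤
      {x : ∀ i, G i | ∃ j, ∀ i, x i - a j i ∈ H j i}.ncard := by
  rcases isEmpty_or_nonempty κ with _ | hκ
  · simp
  have hmax : ∀ S : Set κ, ∃ m, S.Nonempty → m ∈ S ∧ ∀ j ∈ S, H j i₀ ≤ H m i₀ := by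
    intro S
    by_cases hS : S.Nonempty
    · obtain ⟨m, hm, hmS⟩ := S.toFinite.exists_maximalFor (fun j => H j i₀) S hS
      refine ⟨m, fun _ => ⟨hm, fun j hj => ?_⟩⟩
      rcases hH j m with h | h
      · exact h
      · exact hmS hj h
    · exact ⟨hκ.some, fun h => absurd h hS⟩
  choose m hm using hmax
  let S : (∀ i, G i) → Set κ := fun x => {j | ∀ i, i ≠ i₀ → x i - a j i ∈ H j i}
  have hS : ∀ x y : ∀ i, G i, (∀ i, i ≠ i₀ → x i = y i) → S x = S y := by
    intro x y h
    ext j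
    exact forall₂_congr fun i hi => by rw [h i hi]
  refine Set.ncard_le_ncard_of_injOn (fun x => x + Pi.single i₀ (a (m (S x)) i₀)) ?_ ?_
    (Set.toFinite _)
  · rintro x ⟨j, hj⟩
    have hjS : j ∈ S x := fun i hi => by simpa [hi] using hj i
    obtain ⟨hmem, hle⟩ := hm (S x) ⟨j, hjS⟩
    refine ⟨m (S x), fun i => ?_⟩
    by_cases hi : i = i₀
    · subst hi
      simpa using hle j hjS (by simpa using hj i)
    · simpa [hi] using hmem i hi
  · intro x _ y _ hxy
    have hne : ∀ i, i ≠ i₀ → x i = y i := fun i hi => by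
      simpa [hi] using congrFun hxy i
    have hSxy := hS x y hne
    simp only [hSxy] at hxy
    exact add_right_cancel hxy

/-- Among all unions of translates of given product subgroups whose factors form chains, the union
of the subgroups themselves is smallest. -/
theorem ncard_setOf_forall_mem_le [Finite ι] [Finite κ] [Finite (∀ i, G i)]
    (H : κ → ∀ i, AddSubgroup (G i)) (hH : ∀ i j k, H j i ≤ H k i ∨ H k i ≤ H j i)
    (a : κ → ∀ i, G i) :
    {x : ∀ i, G i | ∃ j, ∀ i, x i ∈ H j i}.ncard ≤
      {x : ∀ i, G i | ∃ j, ∀ i, x i - a j i ∈ H j i}.ncard := by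
  classical
  have := Fintype.ofFinite ι
  suffices h : ∀ s : Finset ι,
      {x : ∀ i, G i | ∃ j, ∀ i, x i - (if i ∈ s then 0 else a j i) ∈ H j i}.ncard ≤
        {x : ∀ i, G i | ∃ j, ∀ i, x i - a j i ∈ H j i}.ncard by
    simpa using h Finset.univ
  intro s
  induction s using Finset.induction_on with
  | empty => simp
  | insert i₀ s _ ih =>
    refine le_trans (le_of_eq ?_)
      ((ncard_setOf_sub_update_le H i₀ (hH i₀) fun j i => if i ∈ s then 0 else a j i).trans ih)
    congr! 7 with x j i
    by_cases hi : i = i₀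
    · subst hi; simp
    · simp [hi]

end Translates

/-- Ideals in a quotient of a Dedekind domain by a prime power form a chain. -/
theorem Ideal.le_total_of_quotient_prime_pow {A : Type*} [CommRing A] [IsDedekindDomain A]
    {P : Ideal A} (hP : Prime P) (n : ℕ) (J₁ J₂ : Ideal (A ⧸ P ^ n)) : J₁ ≤ J₂ ∨ J₂ ≤ J₁ := by
  have key : ∀ J : Ideal (A ⧸ P ^ n), ∃ k, J.comap (Ideal.Quotient.mk (P ^ n)) = P ^ k := by
    intro J
    have hdvd : J.comap (Ideal.Quotient.mk (P ^ n)) ∣ P ^ n :=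
      Ideal.dvd_iff_le.mpr fun x hx => by
        simp [Ideal.mem_comap, Ideal.Quotient.eq_zero_iff_mem.mpr hx]
    obtain ⟨k, -, hk⟩ := (dvd_prime_pow hP n).mp hdvd
    exact ⟨k, associated_iff_eq.mp hk⟩
  obtain ⟨k₁, h₁⟩ := key J₁
  obtain ⟨k₂, h₂⟩ := key J₂
  rw [← Ideal.comap_le_comap_iff_of_surjective _ Ideal.Quotient.mk_surjective,
    ← Ideal.comap_le_comap_iff_of_surjective _ Ideal.Quotient.mk_surjective, h₁, h₂]
  exact (le_total k₂ k₁).imp Ideal.pow_le_pow_right Ideal.pow_le_pow_right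

/-- A point of `A` reduces modulo `⨅ j, I j` into the reduction of a union of cosets of the `I j`
iff it lies in one of these cosets. -/
theorem Ideal.mk_mem_image_iUnion_translate {A κ : Type*} [CommRing A] (I : κ → Ideal A)
    (a : κ → A) (x : A) :
    Ideal.Quotient.mk (⨅ j, I j) x ∈
        (Ideal.Quotient.mk (⨅ j, I j)) '' (⋃ j, (a j + ·) '' (I j : Set A)) ↔
      ∃ j, x - a j ∈ I j := by
  constructor
  · rintro ⟨y, hy, hyx⟩
    obtain ⟨j, z, hz, rfl⟩ := Set.mem_iUnion.mp hy
    refine ⟨j, ?_⟩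
    have h := (Ideal.mem_iInf.mp (Ideal.Quotient.eq.mp hyx)) j
    have hx : x - a j = z - (a j + z - x) := by ring
    exact hx ▸ sub_mem hz h
  · rintro ⟨j, hj⟩
    exact ⟨x, Set.mem_iUnion.mpr ⟨j, x - a j, hj, by simp⟩, rfl⟩

theorem Ideal.mk_mem_image_iUnion {A κ : Type*} [CommRing A] (I : κ → Ideal A) (x : A) :
    Ideal.Quotient.mk (⨅ j, I j) x ∈ (Ideal.Quotient.mk (⨅ j, I j)) '' (⋃ j, (I j : Set A)) ↔
      ∃ j, x ∈ I j := by
  simpa using Ideal.mk_mem_image_iUnion_translate I 0 x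

/-- The sieving inequality in a Dedekind domain. -/
theorem IsDedekindDomain.ncard_image_iUnion_le {A κ : Type*} [CommRing A] [IsDedekindDomain A]
    [Finite κ] (I : κ → Ideal A) (hI : (⨅ j, I j) ≠ ⊥) [Finite (A ⧸ ⨅ j, I j)] (a : κ → A) :
    ((Ideal.Quotient.mk (⨅ j, I j)) '' (⋃ j, (I j : Set A))).ncard ≤
      ((Ideal.Quotient.mk (⨅ j, I j)) '' (⋃ j, (a j + ·) '' (I j : Set A))).ncard := by
  classical
  let e := IsDedekindDomain.quotientEquivPiFactors hI
  have := Finite.of_equiv _ e.toEquiv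
  let J : κ → Ideal (A ⧸ ⨅ j, I j) := fun j => (I j).map (Ideal.Quotient.mk _)
  have hJ : ∀ j x, Ideal.Quotient.mk _ x ∈ J j ↔ x ∈ I j := fun j x =>
    Ideal.mem_quotient_iff_mem (iInf_le I j)
  let H := fun j => Ideal.piOrderIso ((J j).map e)
  have hH : ∀ j y, (∀ P, e y P ∈ H j P) ↔ y ∈ J j := by
    intro j y
    rw [← Ideal.mem_pi]
    change e y ∈ Ideal.piOrderIso.symm (H j) ↔ _
    rw [OrderIso.symm_apply_apply, Ideal.mem_map_of_equiv]
    simp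
  have key := ncard_setOf_forall_mem_le (fun j P => (H j P).toAddSubgroup)
    (fun P j k => Ideal.le_total_of_quotient_prime_pow
      (UniqueFactorizationMonoid.prime_of_factor _ (Multiset.mem_toFinset.mp P.prop)) _ _ _)
    (fun j => e (Ideal.Quotient.mk _ (a j)))
  rw [← Set.ncard_preimage_of_injective_subset_range e.injective
      (by simp [e.surjective.range_eq]),
    ← Set.ncard_preimage_of_injective_subset_range e.injective
      (by simp [e.surjective.range_eq])] at key
  convert key using 2
  · ext y
    obtain ⟨x, rfl⟩ := Ideal.Quotient.mk_surjective y
    rw [Ideal.mk_mem_image_iUnion]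
    exact exists_congr fun j => (hJ j x).symm.trans (hH j _).symm
  · ext y
    obtain ⟨x, rfl⟩ := Ideal.Quotient.mk_surjective y
    rw [Ideal.mk_mem_image_iUnion_translate]
    refine exists_congr fun j => (hJ j _).symm.trans ((hH j _).symm.trans ?_)
    simp

/-- If a maximal ideal `P` is not generated by one element modulo `P ^ 2`, then translating one of
the lines of `P / P ^ 2` off the origin makes the union of all lines smaller. -/
theorem Ideal.exists_eq_sq_sup_span_singleton {A : Type*} [CommRing A] (P : Ideal A)
    [hP : P.IsMaximal] (hP2 : P ^ 2 ≠ ⊥) [Finite (A ⧸ P ^ 2)]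
    (hR : ∀ (r : ℕ) (I : Fin r → Ideal A), (∀ j, I j ≠ ⊥) → ∀ a : Fin r → A,
      ((Ideal.Quotient.mk (⨅ j, I j)) '' (⋃ j, (I j : Set A))).ncard ≤
        ((Ideal.Quotient.mk (⨅ j, I j)) '' (⋃ j, (a j + ·) '' (I j : Set A))).ncard) :
    ∃ x, P = P ^ 2 ⊔ Ideal.span {x} := by
  classical
  by_contra! hne
  let L : A → Ideal A := fun x => P ^ 2 ⊔ Ideal.span {x}
  have hsq : P ^ 2 ≤ P := Ideal.pow_le_self two_ne_zero
  have hLP : ∀ x ∈ P, L x ≤ P := fun x hx =>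
    sup_le hsq ((Ideal.span_singleton_le_iff_mem P).mpr hx)
  have hxL : ∀ x, x ∈ L x := fun x =>
    Ideal.mem_sup_right (Ideal.mem_span_singleton_self x)
  have hLL : ∀ x y, x ∈ L y → L x ≤ L y := fun x y h =>
    sup_le le_sup_left ((Ideal.span_singleton_le_iff_mem _).mpr h)
  have hlines : ∀ x ∉ P ^ 2, ∀ y ∈ P, x ∈ L y → L y = L x := by
    intro x hx y hy hxy
    refine le_antisymm (hLL y x ?_) (hLL x y hxy)
    obtain ⟨p, hp, z, hz, rfl⟩ := Submodule.mem_sup.mp hxy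
    obtain ⟨t, rfl⟩ := Ideal.mem_span_singleton'.mp hz
    have ht : t ∉ P := fun ht => hx (add_mem hp (pow_two P ▸ Ideal.mul_mem_mul ht hy))
    obtain ⟨u, q, hq, hu⟩ := hP.exists_inv ht
    have hy' : y = q * y - u * p + u * (p + t * y) := by linear_combination (-y) * hu
    have h1 : q * y - u * p + u * (p + t * y) ∈ L (p + t * y) :=
      add_mem (Ideal.mem_sup_left (sub_mem (pow_two P ▸ Ideal.mul_mem_mul hq hy)
        (Ideal.mul_mem_left _ _ hp))) (Ideal.mul_mem_left _ _ (hxL _))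
    rwa [← hy'] at h1
  obtain ⟨x, hxP, hx⟩ : ∃ x ∈ P, x ∉ P ^ 2 :=
    SetLike.exists_of_lt (hsq.lt_of_ne fun h => hne 0 (by simp [h]))
  obtain ⟨b, hbP, hb⟩ : ∃ b ∈ P, b ∉ L x :=
    SetLike.exists_of_lt ((hLP x hxP).lt_of_ne (hne x).symm)
  let T : Set (Ideal A) := L '' P
  have hT : T.Finite := by
    refine Set.Finite.subset (s := Set.range (Ideal.comap (Ideal.Quotient.mk (P ^ 2))))
      (Set.finite_range _) ?_
    rintro _ ⟨y, -, rfl⟩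
    refine ⟨(L y).map (Ideal.Quotient.mk (P ^ 2)), ?_⟩
    rw [Ideal.comap_map_of_surjective _ Ideal.Quotient.mk_surjective, ← RingHom.ker_eq_comap_bot,
      Ideal.mk_ker]
    exact sup_eq_left.mpr le_sup_left
  have : Finite T := hT
  let ε := Finite.equivFin T
  let I : Fin (Nat.card T) → Ideal A := fun j => (ε.symm j : Ideal A)
  have hIsq : ∀ j, P ^ 2 ≤ I j := by
    intro j
    obtain ⟨y, -, hy⟩ := (ε.symm j).2
    exact le_sup_left.trans hy.le
  have hIP : ∀ j, I j ≤ P := by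
    intro j
    obtain ⟨y, hyP, hy⟩ := (ε.symm j).2
    exact hy.ge.trans (hLP y hyP)
  have hI : ∀ y ∈ P, ∃ j, I j = L y := fun y hy =>
    ⟨ε ⟨L y, y, hy, rfl⟩, congrArg Subtype.val (ε.symm_apply_apply _)⟩
  have : Finite (A ⧸ ⨅ j, I j) :=
    Finite.of_surjective _ (Ideal.Quotient.factor_surjective (le_iInf hIsq))
  let a : Fin (Nat.card T) → A := fun j => if I j = L x then b else 0
  have haP : ∀ j, a j ∈ P := by
    intro j
    by_cases h : I j = L x <;> simp [a, h, hbP]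
  refine (Set.ncard_lt_ncard ?_ (Set.toFinite _)).not_ge
    (hR _ I (fun j h => hP2 (le_bot_iff.mp (h ▸ hIsq j))) a)
  refine (Set.ssubset_iff_of_subset ?_).mpr ⟨Ideal.Quotient.mk _ x, ?_, ?_⟩
  · intro y hy
    obtain ⟨y, rfl⟩ := Ideal.Quotient.mk_surjective y
    obtain ⟨j, hj⟩ := (Ideal.mk_mem_image_iUnion_translate I a y).mp hy
    have hyP : y ∈ P := by simpa using add_mem (hIP j hj) (haP j)
    obtain ⟨k, hk⟩ := hI y hyP
    exact (Ideal.mk_mem_image_iUnion I y).mpr ⟨k, hk ▸ hxL y⟩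
  · obtain ⟨k, hk⟩ := hI x hxP
    exact (Ideal.mk_mem_image_iUnion I x).mpr ⟨k, hk ▸ hxL x⟩
  · rw [Ideal.mk_mem_image_iUnion_translate]
    rintro ⟨j, hj⟩
    by_cases h : I j = L x
    · simp only [a, h, if_true] at hj
      exact hb (by simpa using sub_mem (hxL x) hj)
    · simp only [a, h, if_false, sub_zero] at hj
      obtain ⟨y, hyP, hy⟩ := (ε.symm j).2
      have hIy : I j = L y := hy.symm
      exact h (hIy.trans (hlines x hx y hyP (hIy ▸ hj)))

/-- A Noetherian domain is Dedekind if each nonzero prime `P` is generated by one element modulo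
`P ^ 2`. -/
theorem isDedekindDomain_of_eq_sq_sup_span_singleton {A : Type*} [CommRing A] [IsDomain A]
    [IsNoetherianRing A]
    (h : ∀ P : Ideal A, P ≠ ⊥ → P.IsPrime → ∃ x, P = P ^ 2 ⊔ Ideal.span {x}) :
    IsDedekindDomain A := by
  have : IsDedekindDomainDvr A :=
    { is_dvr_at_nonzero_prime := by
        intro P hP hPp
        obtain ⟨x, hx⟩ := h P hP hPp
        have : IsNoetherianRing (Localization.AtPrime P) :=
          IsLocalization.isNoetherianRing P.primeCompl _ inferInstance
        have hfield : ¬ IsField (Localization.AtPrime P) :=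
          IsLocalization.AtPrime.not_isField A hP _
        refine ((IsDiscreteValuationRing.TFAE _ hfield).out 0 4).mpr ?_
        let f := algebraMap A (Localization.AtPrime P)
        refine ⟨f x, le_antisymm ?_ ?_⟩
        · refine Submodule.le_of_le_smul_of_le_jacobson_bot
            (I := IsLocalRing.maximalIdeal (Localization.AtPrime P))
            (IsNoetherian.noetherian _) (IsLocalRing.maximalIdeal_le_jacobson _) ?_
          have hm := congrArg (Ideal.map f) hx
          rw [Ideal.map_sup, Ideal.map_pow, Ideal.map_span, Set.image_singleton,
            Localization.AtPrime.map_eq_maximalIdeal, pow_two, sup_comm] at hm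
          exact hm.le
        · rw [← Localization.AtPrime.map_eq_maximalIdeal]
          refine (Ideal.span_singleton_le_iff_mem _).mpr (Ideal.mem_map_of_mem _ ?_)
          rw [hx]
          exact Ideal.mem_sup_right (Ideal.mem_span_singleton_self x) }
  infer_instance

/-- A ring of algebraic integers in a number field is a finitely generated abelian group. -/
theorem Subalgebra.module_finite_of_forall_isIntegral {K : Type*} [Field K] [NumberField K]
    (O : Subalgebra ℤ K) (hint : ∀ x ∈ O, IsIntegral ℤ x) : Module.Finite ℤ O := by
  have hle : O ≤ integralClosure ℤ K := hint
  let f : O →ₗ[ℤ] NumberField.RingOfIntegers K := (Subalgebra.inclusion hle).toLinearMap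
  exact Module.Finite.of_injective f (Subalgebra.inclusion_injective hle)


/-- **Theorem 1 of the paper.** An order `O` in a number field `K`
(a `ℤ`-subalgebra of `K` consisting of algebraic integers and spanning `K` over `ℚ`)
is a Dedekind domain iff every finite set of nonzero ideals `I₁, …, I_r` of `O`
satisfies the sieving condition (R): for all `a₁, …, a_r ∈ O`,
`|π (⋃ⱼ (aⱼ + Iⱼ))| ≥ |π (⋃ⱼ Iⱼ)|`, where `π : O → O ⧸ (⨅ⱼ Iⱼ)` is the projection. -/
theorem rogers_for_orders (K : Type*) [Field K] [NumberField K]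
    (O : Subalgebra ℤ K) (hint : ∀ x ∈ O, IsIntegral ℤ x)
    (hspan : Submodule.span ℚ (O : Set K) = ⊤) :
    IsDedekindDomain O ↔
      ∀ (r : ℕ) (I : Fin r → Ideal O), (∀ j, I j ≠ ⊥) →
        ∀ a : Fin r → O,
          ((Ideal.Quotient.mk (⨅ j, I j)) '' (⋃ j, (I j : Set O))).ncard ≤
            ((Ideal.Quotient.mk (⨅ j, I j)) ''
              (⋃ j, (a j + ·) '' (I j : Set O))).ncard := by
  have := O.module_finite_of_forall_isIntegral hint
  have : Module.Free ℤ O := inferInstance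
  have : IsNoetherianRing O := IsNoetherianRing.of_finite ℤ O
  have hfin : ∀ I : Ideal O, I ≠ ⊥ → Finite (O ⧸ I) := Ideal.finiteQuotientOfFreeOfNeBot
  constructor
  · intro _ r I hI a
    have hinf : (⨅ j, I j) ≠ ⊥ := by
      rw [← Finset.inf_univ_eq_iInf]
      refine ne_bot_of_le_ne_bot ?_ Ideal.prod_le_inf
      exact Finset.prod_ne_zero_iff.mpr fun j _ => hI j
    have := hfin _ hinf
    exact IsDedekindDomain.ncard_image_iUnion_le I hinf a
  · intro hR
    refine isDedekindDomain_of_eq_sq_sup_span_singleton fun P hP hPp => ?_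
    have hP2 : P ^ 2 ≠ ⊥ := pow_ne_zero 2 hP
    have := hfin P hP
    have := hfin _ hP2
    have : P.IsMaximal := Ideal.Quotient.maximal_of_isField P (Finite.isField_of_domain (O ⧸ P))
    exact P.exists_eq_sq_sup_span_singleton hP2 hR
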